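/- For every even integer n ≥ 8, the polynomial identity 2x²·B_{n−2}(x) − B_n(x) = −C_n + x² · Σ_{j even, 4 ≤ j ≤ n−4} B_j(x) · ( x²·C_{n−2−j} − C_{n−j} ) holds. -/

import Mathlib

/-- `C_{2r} = 2·((r−1)!)²/(2r)!` for `r ≥ 1`, the Taylor coefficients of
`4·arcsin(z/2)² = Σ_{r≥1} C_{2r} z^{2r}`. -/
noncomputable def Ccoef (m : ℕ) : ℝ :=
  2 * ((m / 2 - 1).factorial : ℝ) ^ 2 / (m.factorial : ℝ)

/-- `B_n(x) = Σ x^{2k−2}·Π_{j=1}^k C_{2 i_j}`, the sum over all `k ≥ 1` and all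
compositions `(i_1,…,i_k)` of `n/2` into positive parts other than the all-ones
composition (so `B_0 = B_2 = 0`). -/
noncomputable def Bfun (n : ℕ) (x : ℝ) : ℝ :=
  ∑ᶠ p ∈ {p : Σ k : ℕ, Fin k → ℕ |
      1 ≤ p.1 ∧ (∀ j, 0 < p.2 j) ∧ (∑ j, p.2 j) = n / 2 ∧ p.2 ≠ fun _ => 1},
    x ^ (2 * p.1 - 2) * ∏ j, Ccoef (2 * p.2 j)

noncomputable def cc (r : ℕ) : ℝ := if r = 0 then 0 else Ccoef (2 * r)

noncomputable def FF : PowerSeries ℝ := PowerSeries.mk cc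

noncomputable def AA (y : ℝ) (N m : ℕ) : ℝ :=
  ∑ k ∈ Finset.range N, y ^ k * PowerSeries.coeff m (FF ^ (k + 1))

lemma FF_dvd : (PowerSeries.X : PowerSeries ℝ) ∣ FF := by
  rw [PowerSeries.X_dvd_iff]; simp [FF, cc, ← PowerSeries.coeff_zero_eq_constantCoeff_apply]

lemma coeff_FF_pow_zero {m k : ℕ} (h : m < k) : PowerSeries.coeff m (FF ^ k) = 0 :=
  (PowerSeries.X_pow_dvd_iff.1 (pow_dvd_pow_of_dvd FF_dvd k)) m h

lemma AA_succ (y : ℝ) (N m : ℕ) (h : m ≤ N) : AA y (N + 1) m = AA y N m := by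
  unfold AA
  rw [Finset.sum_range_succ, coeff_FF_pow_zero (by omega)]; simp

lemma AA_rec (y : ℝ) (N m : ℕ) (h : m ≤ N) :
    AA y N m = cc m + y * ∑ j ∈ Finset.range (m + 1), AA y N j * cc (m - j) := by
  rw [← AA_succ y N m h]
  conv_lhs => unfold AA
  rw [Finset.sum_range_succ']
  have h1 : ∀ k, PowerSeries.coeff m (FF ^ (k + 1 + 1)) =
      ∑ j ∈ Finset.range (m + 1), PowerSeries.coeff j (FF ^ (k + 1)) * cc (m - j) := by
    intro k
    rw [pow_succ, PowerSeries.coeff_mul, Finset.Nat.sum_antidiagonal_eq_sum_range_succ_mk]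
    simp [FF]
  simp only [h1, AA, Finset.sum_mul, Finset.mul_sum]
  rw [Finset.sum_comm, add_comm]
  congr 1
  · simp [FF]
  · exact Finset.sum_congr rfl fun j _ => Finset.sum_congr rfl fun k _ => by ring

lemma coeff_FF_pow (m k : ℕ) : PowerSeries.coeff m (FF ^ k) =
    ∑ f ∈ (Finset.piAntidiag (Finset.univ : Finset (Fin k)) m).filter (fun f => ∀ j, 0 < f j),
      ∏ j, Ccoef (2 * f j) := by
  have : FF ^ k = ∏ _j : Fin k, FF := by simp
  rw [this, PowerSeries.coeff_prod, Finset.sum_filter]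
  refine Finset.sum_bij' (fun f _ => ⇑f) (fun f _ => Finsupp.equivFunOnFinite.symm f) ?_ ?_ ?_ ?_ ?_
  · intro f hf; simpa using hf
  · intro f hf; simpa using hf
  · intro f hf; ext; simp
  · intro f hf; ext; simp
  · intro f hf
    split_ifs with h
    · exact Finset.prod_congr rfl fun j _ => by simp [FF, cc, (h j).ne']
    · push Not at h
      obtain ⟨j, hj⟩ := h
      exact Finset.prod_eq_zero (Finset.mem_univ j) (by simp [FF, cc, Nat.le_zero.1 hj])

lemma Bfun_eq (m : ℕ) (hm : 1 ≤ m) (N : ℕ) (hN : m ≤ N) (x : ℝ) :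
    Bfun (2 * m) x = AA (x ^ 2) N m - (x ^ 2) ^ (m - 1) := by
  classical
  have hc : Ccoef 2 = 1 := by norm_num [Ccoef]
  let s : Finset (Σ k : ℕ, Fin k → ℕ) := (Finset.Icc 1 N).sigma fun k =>
    (Finset.piAntidiag (Finset.univ : Finset (Fin k)) m).filter (fun f => ∀ j, 0 < f j)
  have hset : {p : Σ k : ℕ, Fin k → ℕ |
      1 ≤ p.1 ∧ (∀ j, 0 < p.2 j) ∧ (∑ j, p.2 j) = 2 * m / 2 ∧ p.2 ≠ fun _ => 1} =
      ↑(s.filter fun p => ¬ (p.2 = fun _ => 1)) := by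
    ext ⟨k, f⟩
    simp only [s, Set.mem_ofPred_eq, Finset.coe_filter, Finset.mem_sigma, Finset.mem_Icc,
      Finset.mem_filter, Finset.mem_piAntidiag, Nat.mul_div_cancel_left m two_pos]
    constructor
    · rintro ⟨h1, h2, h3, h4⟩
      refine ⟨⟨⟨h1, ?_⟩, ⟨h3, by simp⟩, h2⟩, h4⟩
      have : ∑ j : Fin k, 1 ≤ ∑ j, f j := Finset.sum_le_sum fun j _ => h2 j
      simp at this
      omega
    · rintro ⟨⟨⟨h1, _⟩, ⟨h3, _⟩, h2⟩, h4⟩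
      exact ⟨h1, h2, h3, h4⟩
  have hA : AA (x ^ 2) N m = ∑ p ∈ s, x ^ (2 * p.1 - 2) * ∏ j, Ccoef (2 * p.2 j) := by
    rw [Finset.sum_sigma, AA, Finset.range_eq_Ico]
    refine (Finset.sum_Ico_add'
      (fun k => (x ^ 2) ^ (k - 1) * PowerSeries.coeff m (FF ^ k)) 0 N 1).trans ?_
    refine Finset.sum_congr (by ext; simp) fun k hk => ?_
    rw [coeff_FF_pow, Finset.mul_sum, ← pow_mul, Nat.mul_sub]
  have h1 : s.filter (fun p => p.2 = fun _ => 1) = {⟨m, fun _ => 1⟩} := by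
    ext ⟨k, f⟩
    simp only [s, Finset.mem_sigma, Finset.mem_Icc,
      Finset.mem_filter, Finset.mem_piAntidiag, Finset.mem_singleton]
    constructor
    · rintro ⟨⟨_, ⟨h3, _⟩, _⟩, h4⟩
      subst h4
      simp at h3
      subst h3
      rfl
    · intro h
      cases h
      simp; omega
  rw [Bfun, hset, finsum_mem_coe_finset, hA,
    ← Finset.sum_filter_add_sum_filter_not s (fun p => p.2 = fun _ => 1), h1]
  simp [hc, ← pow_mul, Nat.mul_sub]

theorem Bfun_two_x_sq_recursion (n : ℕ) (hn : 8 ≤ n) (hne : Even n) (x : ℝ) :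
    2 * x ^ 2 * Bfun (n - 2) x - Bfun n x =
      -Ccoef n + x ^ 2 * ∑ j ∈ (Finset.Icc 4 (n - 4)).filter (fun j => Even j),
        Bfun j x * (x ^ 2 * Ccoef (n - 2 - j) - Ccoef (n - j)) := by
  obtain ⟨m, hm⟩ := hne
  obtain ⟨t, rfl⟩ : ∃ t, m = t + 3 := ⟨m - 3, by omega⟩
  obtain rfl : n = 2 * (t + 3) := by omega
  have hc1 : cc 1 = 1 := by norm_num [cc, Ccoef]
  have hc0 : cc 0 = 0 := by simp [cc]
  set y := x ^ 2 with hy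
  set a : ℕ → ℝ := AA y (t + 3) with ha
  have hrec : ∀ m ≤ t + 3, a m = cc m + y * ∑ j ∈ Finset.range (m + 1), a j * cc (m - j) :=
    fun m h => AA_rec y (t + 3) m h
  have hB : ∀ m, 1 ≤ m → m ≤ t + 3 → Bfun (2 * m) x = a m - y ^ (m - 1) :=
    fun m h h' => Bfun_eq m h (t + 3) h' x
  have hC : ∀ r, 1 ≤ r → Ccoef (2 * r) = cc r := fun r h => by simp [cc]; omega
  have ha0 : a 0 = 0 := by
    have := hrec 0 (by omega)
    simpa [hc0] using this
  have ha1 : a 1 = 1 := by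
    have := hrec 1 (by omega)
    simpa [hc0, hc1, ha0, Finset.sum_range_succ] using this
  have hsum : ∑ j ∈ (Finset.Icc 4 (2 * (t + 3) - 4)).filter (fun j => Even j),
        Bfun j x * (y * Ccoef (2 * (t + 3) - 2 - j) - Ccoef (2 * (t + 3) - j)) =
      ∑ i ∈ Finset.range t, (a (i + 2) - y ^ (i + 1)) * (y * cc (t - i) - cc (t + 1 - i)) := by
    symm
    refine Finset.sum_bij' (fun i _ => 2 * (i + 2)) (fun j _ => j / 2 - 2) ?_ ?_ ?_ ?_ ?_
    · intro i hi
      simp only [Finset.mem_range] at hi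
      simp only [Finset.mem_filter, Finset.mem_Icc]
      exact ⟨by omega, even_two_mul _⟩
    · intro j hj
      simp only [Finset.mem_filter, Finset.mem_Icc] at hj
      obtain ⟨_, r, rfl⟩ := hj
      simp only [Finset.mem_range]; omega
    · intro i hi
      omega
    · intro j hj
      simp only [Finset.mem_filter, Finset.mem_Icc] at hj
      obtain ⟨_, r, rfl⟩ := hj
      omega
    · intro i hi
      simp only [Finset.mem_range] at hi
      rw [hB (i + 2) (by omega) (by omega), ← hC (t - i) (by omega), ← hC (t + 1 - i) (by omega)]
      congr 4 <;> omega
  have htel : ∑ i ∈ Finset.range t, y ^ (i + 1) * (y * cc (t - i) - cc (t + 1 - i)) =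
      y ^ (t + 1) - y * cc (t + 1) := by
    have := Finset.sum_range_sub (fun i => y ^ (i + 1) * cc (t + 1 - i)) t
    simp only [Nat.add_sub_cancel_left, hc1, mul_one, zero_add, pow_one, Nat.sub_zero] at this
    rw [← this]
    refine Finset.sum_congr rfl fun i hi => ?_
    rw [Nat.add_sub_add_right]; ring
  have e3 := hrec (t + 3) le_rfl
  have e2 := hrec (t + 2) (by omega)
  rw [Finset.sum_range_succ, Finset.sum_range_succ, Finset.sum_range_succ',
    Finset.sum_range_succ'] at e3
  rw [Finset.sum_range_succ, Finset.sum_range_succ', Finset.sum_range_succ'] at e2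
  have s1 : t + 3 - (t + 2) = 1 := by omega
  have s2 : ∀ i, t + 3 - (i + 1 + 1) = t + 1 - i := by omega
  have s3 : ∀ i, t + 2 - (i + 1 + 1) = t - i := by omega
  have s4 : t + 3 - (0 + 1) = t + 2 := by omega
  have s5 : t + 2 - (0 + 1) = t + 1 := by omega
  simp only [Nat.sub_self, hc0, s1, s2, s3, s4, s5, hc1, ha0, zero_add, ha1] at e3 e2
  rw [hsum, hC _ (by omega), hB (t + 3) (by omega) le_rfl,
    show 2 * (t + 3) - 2 = 2 * (t + 2) by omega, hB (t + 2) (by omega) (by omega)]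
  simp only [sub_mul, Finset.sum_sub_distrib, htel]
  simp only [mul_sub, Finset.sum_sub_distrib]
  have hl : ∑ i ∈ Finset.range t, a (i + 2) * (y * cc (t - i)) =
      y * ∑ i ∈ Finset.range t, a (i + 2) * cc (t - i) := by
    rw [Finset.mul_sum]; exact Finset.sum_congr rfl fun i _ => by ring
  rw [hl]
  have p1 : t + 3 - 1 = t + 2 := rfl
  have p2 : t + 2 - 1 = t + 1 := rfl
  rw [p1, p2]
  simp only [add_assoc, Nat.reduceAdd] at e3 e2 ⊢
  linear_combination y * e2 - e3
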